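/- Under the setting above with μ ∈ (0,(1+√5)/2), A^T A and B^T B positive definite, the full ADMM sequence (θ^k, ξ^k, Λ^k) is bounded, every accumulation point satisfies the KKT conditions y = A^TΛ^∞, B^TΛ^∞ ∈ ∂g(ξ^∞), Aθ^∞ + Bξ^∞ = 0, and the whole sequence converges: (θ^k, ξ^k) converges to an optimal solution of min ⟨y,θ⟩ + g(ξ) s.t. Aθ + Bξ = 0, and Λ^k converges to an associated Lagrange multiplier. -/

import Mathlib

open Matrix Filter

/-- `v` is a subgradient of `g` at `x`. -/
def IsSubgradient {q : ℕ} (g : (Fin q → ℝ) → ℝ) (x v : Fin q → ℝ) : Prop :=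
  ∀ z, g x + v ⬝ᵥ (z - x) ≤ g z

/-- The KKT conditions of `min ⟨y,θ⟩ + g(ξ)` s.t. `Aθ + Bξ = 0`. -/
structure IsKKT {n m q : ℕ} (A : Matrix (Fin n) (Fin m) ℝ) (B : Matrix (Fin n) (Fin q) ℝ)
    (y : Fin m → ℝ) (g : (Fin q → ℝ) → ℝ)
    (θ : Fin m → ℝ) (ξ : Fin q → ℝ) (Λ : Fin n → ℝ) : Prop where
  stationary : Aᵀ *ᵥ Λ = y
  subgradient : IsSubgradient g ξ (Bᵀ *ᵥ Λ)
  feasible : A *ᵥ θ + B *ᵥ ξ = 0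

/-- The first-order description of the ADMM iteration. -/
structure IsADMM {n m q : ℕ} (σ μ : ℝ) (A : Matrix (Fin n) (Fin m) ℝ)
    (B : Matrix (Fin n) (Fin q) ℝ) (y : Fin m → ℝ) (g : (Fin q → ℝ) → ℝ)
    (θ : ℕ → Fin m → ℝ) (ξ : ℕ → Fin q → ℝ) (Λ : ℕ → Fin n → ℝ) : Prop where
  stationary : ∀ k, Aᵀ *ᵥ (Λ k - σ • (A *ᵥ θ (k+1) + B *ᵥ ξ k)) = y
  subgradient : ∀ k, IsSubgradient g (ξ (k+1))
    (Bᵀ *ᵥ (Λ k - σ • (A *ᵥ θ (k+1) + B *ᵥ ξ (k+1))))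
  dual : ∀ k, Λ (k+1) = Λ k - (μ * σ) • (A *ᵥ θ (k+1) + B *ᵥ ξ (k+1))

/-- The Lyapunov function of ADMM relative to a reference point `(ξs, Λs)`. -/
noncomputable def lyapunov {n m q : ℕ} (σ μ c : ℝ) (A : Matrix (Fin n) (Fin m) ℝ)
    (B : Matrix (Fin n) (Fin q) ℝ) (ξs : Fin q → ℝ) (Λs : Fin n → ℝ)
    (θ : Fin m → ℝ) (ξ : Fin q → ℝ) (Λ : Fin n → ℝ) : ℝ :=
  (Λ - Λs) ⬝ᵥ (Λ - Λs) / (μ * σ ^ 2) + (B *ᵥ ξ - B *ᵥ ξs) ⬝ᵥ (B *ᵥ ξ - B *ᵥ ξs)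
    + c * ((A *ᵥ θ + B *ᵥ ξ) ⬝ᵥ (A *ᵥ θ + B *ᵥ ξ))

lemma dotProduct_self_nonneg_real {n : ℕ} (v : Fin n → ℝ) : 0 ≤ v ⬝ᵥ v :=
  Finset.sum_nonneg fun i _ => mul_self_nonneg (v i)

lemma transpose_mulVec_dotProduct {n m : ℕ} (A : Matrix (Fin n) (Fin m) ℝ)
    (v : Fin n → ℝ) (h : Fin m → ℝ) : (Aᵀ *ᵥ v) ⬝ᵥ h = v ⬝ᵥ (A *ᵥ h) := by
  rw [mulVec_transpose, dotProduct_mulVec]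

lemma sq_apply_le_dotProduct_self {n : ℕ} (v : Fin n → ℝ) (i : Fin n) : v i ^ 2 ≤ v ⬝ᵥ v := by
  rw [sq]
  exact Finset.single_le_sum (f := fun i => v i * v i) (fun i _ => mul_self_nonneg (v i))
    (Finset.mem_univ i)

lemma norm_le_of_dotProduct_self_le {n : ℕ} {v : Fin n → ℝ} {M : ℝ} (h : v ⬝ᵥ v ≤ M) :
    ‖v‖ ≤ √M :=
  (pi_norm_le_iff_of_nonneg (Real.sqrt_nonneg M)).2 fun i =>
    Real.abs_le_sqrt ((sq_apply_le_dotProduct_self v i).trans h)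

lemma tendsto_zero_of_dotProduct_self {n : ℕ} {v : ℕ → Fin n → ℝ}
    (h : Tendsto (fun k => v k ⬝ᵥ v k) atTop (nhds 0)) : Tendsto v atTop (nhds 0) := by
  refine squeeze_zero_norm (fun k => norm_le_of_dotProduct_self_le le_rfl) ?_
  simpa using h.sqrt

lemma tendsto_mulVec {n m : ℕ} (A : Matrix (Fin n) (Fin m) ℝ) {v : ℕ → Fin m → ℝ}
    {x : Fin m → ℝ} (h : Tendsto v atTop (nhds x)) :
    Tendsto (fun k => A *ᵥ v k) atTop (nhds (A *ᵥ x)) :=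
  ((continuous_const.matrix_mulVec continuous_id).tendsto x).comp h

lemma tendsto_dotProduct {n : ℕ} {v w : ℕ → Fin n → ℝ}
    {x z : Fin n → ℝ} (hv : Tendsto v atTop (nhds x)) (hw : Tendsto w atTop (nhds z)) :
    Tendsto (fun k => v k ⬝ᵥ w k) atTop (nhds (x ⬝ᵥ z)) :=
  ((continuous_fst.dotProduct continuous_snd).tendsto (x, z)).comp (hv.prodMk_nhds hw)

lemma exists_leftInverse_of_posDef {n m : ℕ} {A : Matrix (Fin n) (Fin m) ℝ}
    (hA : (Aᵀ * A).PosDef) : ∃ L : Matrix (Fin m) (Fin n) ℝ, ∀ x, L *ᵥ (A *ᵥ x) = x := by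
  refine ⟨(Aᵀ * A)⁻¹ * Aᵀ, fun x => ?_⟩
  rw [mulVec_mulVec, Matrix.mul_assoc,
    Matrix.nonsing_inv_mul _ ((Matrix.isUnit_iff_isUnit_det _).1 hA.isUnit), one_mulVec]

lemma tendsto_of_tendsto_mulVec {n m : ℕ} {A : Matrix (Fin n) (Fin m) ℝ}
    (hA : (Aᵀ * A).PosDef) {v : ℕ → Fin m → ℝ} {w : Fin n → ℝ}
    (h : Tendsto (fun k => A *ᵥ v k) atTop (nhds w)) : ∃ x, Tendsto v atTop (nhds x) := by
  obtain ⟨L, hL⟩ := exists_leftInverse_of_posDef hA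
  exact ⟨L *ᵥ w, by simpa only [hL] using tendsto_mulVec L h⟩

lemma nonneg_of_forall_quadratic_nonneg {a c : ℝ} (hc : 0 ≤ c)
    (h : ∀ t, 0 < t → t ≤ 1 → 0 ≤ t * a + t ^ 2 * c) : 0 ≤ a := by
  by_contra! ha
  have hpos : 0 < c - a := by linarith
  have hd : 0 < -a / (2 * (c - a)) := by apply div_pos <;> linarith
  have hd1 : -a / (2 * (c - a)) ≤ 1 := by rw [div_le_one (by linarith)]; linarith
  have h1 := h _ hd hd1
  have h2 : 0 ≤ a + -a / (2 * (c - a)) * c := by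
    refine nonneg_of_mul_nonneg_right ?_ hd
    linarith
  have h3 : -a / (2 * (c - a)) * c ≤ -a / 2 := by
    rw [div_mul_eq_mul_div, div_le_div_iff₀ (by linarith) two_pos]
    nlinarith
  linarith

/-- First-order optimality for a convex function plus an augmented Lagrangian term. -/
lemma isSubgradient_of_isMin {n q : ℕ} {σ : ℝ} (hσ : 0 < σ) (B : Matrix (Fin n) (Fin q) ℝ)
    {g : (Fin q → ℝ) → ℝ} (hg : ConvexOn ℝ Set.univ g) (b w : Fin n → ℝ) (x : Fin q → ℝ)
    (h : ∀ s, g x - b ⬝ᵥ (B *ᵥ x) + (σ / 2) * ((w + B *ᵥ x) ⬝ᵥ (w + B *ᵥ x))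
      ≤ g s - b ⬝ᵥ (B *ᵥ s) + (σ / 2) * ((w + B *ᵥ s) ⬝ᵥ (w + B *ᵥ s))) :
    IsSubgradient g x (Bᵀ *ᵥ (b - σ • (w + B *ᵥ x))) := by
  intro z
  rw [transpose_mulVec_dotProduct]
  set e := B *ᵥ (z - x) with he
  set v := w + B *ᵥ x with hv
  suffices 0 ≤ g z - g x - (b - σ • v) ⬝ᵥ e by linarith
  refine nonneg_of_forall_quadratic_nonneg (c := σ / 2 * (e ⬝ᵥ e))
    (mul_nonneg (by linarith) (dotProduct_self_nonneg_real e)) fun t ht ht1 => ?_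
  have h1 := h (x + t • (z - x))
  have h2 := hg.2 (Set.mem_univ x) (Set.mem_univ z) (sub_nonneg.2 ht1) ht.le (by ring)
  have h3 : (1 - t) • x + t • z = x + t • (z - x) := by module
  have h4 : B *ᵥ (x + t • (z - x)) = B *ᵥ x + t • e := by
    rw [mulVec_add, mulVec_smul]
  rw [h3, smul_eq_mul, smul_eq_mul] at h2
  rw [h4, ← add_assoc, ← hv] at h1
  simp only [dotProduct_add, add_dotProduct, dotProduct_smul, smul_dotProduct, smul_eq_mul,
    sub_dotProduct, dotProduct_comm e v] at h1 ⊢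
  linarith

lemma IsSubgradient.monotone {q : ℕ} {g : (Fin q → ℝ) → ℝ} {x x' v v' : Fin q → ℝ}
    (h : IsSubgradient g x v) (h' : IsSubgradient g x' v') : 0 ≤ (v' - v) ⬝ᵥ (x' - x) := by
  have h1 := h x'
  have h2 := h' x
  simp only [dotProduct_sub, sub_dotProduct] at *
  linarith

lemma eq_of_isSubgradient_linear {m : ℕ} {y x v : Fin m → ℝ}
    (h : IsSubgradient (fun t => y ⬝ᵥ t) x v) : v = y := by
  have h1 := h (x + (v - y))
  rw [← sub_eq_zero, ← dotProduct_self_eq_zero]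
  refine le_antisymm ?_ (dotProduct_self_nonneg_real _)
  simp only [dotProduct_add, add_sub_cancel_left, sub_dotProduct] at *
  linarith

/-- The graph of the subdifferential of a lower semicontinuous function is closed. -/
lemma IsSubgradient.of_tendsto {q : ℕ} {g : (Fin q → ℝ) → ℝ} (hg : LowerSemicontinuous g)
    {x v : ℕ → Fin q → ℝ} {x₀ v₀ : Fin q → ℝ} (hx : Tendsto x atTop (nhds x₀))
    (hv : Tendsto v atTop (nhds v₀)) (h : ∀ᶠ k in atTop, IsSubgradient g (x k) (v k)) :
    IsSubgradient g x₀ v₀ := by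
  intro z
  have hlim : Tendsto (fun k => g z - v k ⬝ᵥ (z - x k)) atTop (nhds (g z - v₀ ⬝ᵥ (z - x₀))) :=
    tendsto_const_nhds.sub (tendsto_dotProduct hv (tendsto_const_nhds.sub hx))
  suffices g x₀ ≤ g z - v₀ ⬝ᵥ (z - x₀) by linarith
  refine le_of_forall_lt fun c hc => ?_
  obtain ⟨c', hc', hc''⟩ := exists_between hc
  refine hc'.trans_le (ge_of_tendsto hlim ?_)
  filter_upwards [h, hx.eventually (hg x₀ c' hc'')] with k hk hk'
  have := hk z
  linarith

/-- The step-length condition `μ < (1+√5)/2` provides a decrease constant. -/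
lemma exists_decrease_constants {μ : ℝ} (hμ : μ ∈ Set.Ioo (0:ℝ) ((1 + √5) / 2)) :
    ∃ c δ : ℝ, 0 ≤ c ∧ 0 < δ ∧ ∀ X D R S : ℝ, 0 ≤ X → 0 ≤ D → 0 ≤ R →
      (∀ t : ℝ, 0 ≤ t ^ 2 * D + 2 * t * S + R) →
      (c + δ) * X + δ * D - c * R ≤ (2 - μ) * X + D - 2 * (1 - μ) * S := by
  obtain ⟨h0, h1⟩ := hμ
  rcases le_total μ 1 with h | h
  · refine ⟨1 - μ, μ, by linarith, h0, fun X D R S hX hD hR hS => ?_⟩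
    have := mul_nonneg (sub_nonneg.2 h) (hS (-1))
    nlinarith
  · have h5 : √5 ^ 2 = 5 := Real.sq_sqrt (by norm_num)
    have hpos : 0 < 1 + μ - μ ^ 2 := by
      nlinarith [Real.sqrt_nonneg 5]
    have hdiv : (1 + μ - μ ^ 2) / μ ≤ 1 + μ - μ ^ 2 := div_le_self hpos.le h
    refine ⟨1 - 1 / μ, (1 + μ - μ ^ 2) / μ, ?_, div_pos hpos h0,
      fun X D R S hX hD hR hS => ?_⟩
    · rw [sub_nonneg, div_le_one h0]
      exact h
    · have key := mul_nonneg (div_nonneg (sub_nonneg.2 h) h0.le) (hS μ)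
      have e1 : (μ - 1) / μ * (μ ^ 2 * D + 2 * μ * S + R)
          = (μ ^ 2 - μ) * D + 2 * (μ - 1) * S + (1 - 1 / μ) * R := by
        field_simp
      have e2 : 1 - 1 / μ + (1 + μ - μ ^ 2) / μ = 2 - μ := by
        field_simp
        ring
      rw [e2]
      have := mul_le_mul_of_nonneg_right hdiv hD
      linarith

/-- One-step decrease of the Lyapunov function, in terms of the residuals. -/
lemma residual_decrease {n : ℕ} {σ μ c δ : ℝ} (hσ : 0 < σ) (hμ : 0 < μ)
    (hcδ : ∀ X D R S : ℝ, 0 ≤ X → 0 ≤ D → 0 ≤ R →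
      (∀ t : ℝ, 0 ≤ t ^ 2 * D + 2 * t * S + R) →
      (c + δ) * X + δ * D - c * R ≤ (2 - μ) * X + D - 2 * (1 - μ) * S)
    (u p r d r' : Fin n → ℝ)
    (h1 : (u - σ • r' + σ • d) ⬝ᵥ (r' - (p + d)) = 0)
    (h2 : 0 ≤ (u - σ • r') ⬝ᵥ (p + d))
    (h3 : 0 ≤ ((1 - μ) • r - r') ⬝ᵥ d) :
    (u - (μ * σ) • r') ⬝ᵥ (u - (μ * σ) • r') / (μ * σ ^ 2) + (p + d) ⬝ᵥ (p + d)
        + c * (r' ⬝ᵥ r') + δ * (r' ⬝ᵥ r' + d ⬝ᵥ d)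
      ≤ u ⬝ᵥ u / (μ * σ ^ 2) + p ⬝ᵥ p + c * (r ⬝ᵥ r) := by
  have key := hcδ (r' ⬝ᵥ r') (d ⬝ᵥ d) (r ⬝ᵥ r) (d ⬝ᵥ r) (dotProduct_self_nonneg_real _)
    (dotProduct_self_nonneg_real _) (dotProduct_self_nonneg_real _) fun t => by
      have := dotProduct_self_nonneg_real (t • d + r)
      simp only [dotProduct_add, add_dotProduct, dotProduct_smul, smul_dotProduct, smul_eq_mul,
        dotProduct_comm r d] at this
      linarith
  have hu : (u - (μ * σ) • r') ⬝ᵥ (u - (μ * σ) • r') / (μ * σ ^ 2)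
      = u ⬝ᵥ u / (μ * σ ^ 2) - 2 / σ * (u ⬝ᵥ r') + μ * (r' ⬝ᵥ r') := by
    simp only [dotProduct_sub, sub_dotProduct, dotProduct_smul, smul_dotProduct, smul_eq_mul,
      dotProduct_comm r' u]
    field_simp
    ring
  have hsum : 0 ≤ 2 / σ * ((u - σ • r' + σ • d) ⬝ᵥ (r' - (p + d)) + (u - σ • r') ⬝ᵥ (p + d)) := by
    rw [h1, zero_add]
    positivity
  have hexp : 2 / σ * ((u - σ • r' + σ • d) ⬝ᵥ (r' - (p + d)) + (u - σ • r') ⬝ᵥ (p + d))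
      = 2 / σ * (u ⬝ᵥ r') - 2 * (r' ⬝ᵥ r') + 2 * (d ⬝ᵥ r') - 2 * (p ⬝ᵥ d) - 2 * (d ⬝ᵥ d) := by
    simp only [dotProduct_sub, sub_dotProduct, dotProduct_add, add_dotProduct,
      smul_dotProduct, smul_eq_mul, dotProduct_comm d p]
    field_simp
    ring
  rw [hexp] at hsum
  rw [hu]
  simp only [sub_dotProduct, dotProduct_add, add_dotProduct,
    smul_dotProduct, smul_eq_mul, dotProduct_comm d p, dotProduct_comm r d,
    dotProduct_comm r' d] at h3 hsum ⊢
  linarith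

section Convergence

variable {n m q : ℕ} {σ μ c δ : ℝ} {A : Matrix (Fin n) (Fin m) ℝ} {B : Matrix (Fin n) (Fin q) ℝ}
  {y : Fin m → ℝ} {g : (Fin q → ℝ) → ℝ}
  {θ : ℕ → Fin m → ℝ} {ξ : ℕ → Fin q → ℝ} {Λ : ℕ → Fin n → ℝ}
  {θs : Fin m → ℝ} {ξs : Fin q → ℝ} {Λs : Fin n → ℝ}

lemma IsADMM.lyapunov_decrease (h : IsADMM σ μ A B y g θ ξ Λ) (hs : IsKKT A B y g θs ξs Λs)
    (hσ : 0 < σ) (hμ : 0 < μ)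
    (hcδ : ∀ X D R S : ℝ, 0 ≤ X → 0 ≤ D → 0 ≤ R →
      (∀ t : ℝ, 0 ≤ t ^ 2 * D + 2 * t * S + R) →
      (c + δ) * X + δ * D - c * R ≤ (2 - μ) * X + D - 2 * (1 - μ) * S) (k : ℕ) :
    lyapunov σ μ c A B ξs Λs (θ (k+2)) (ξ (k+2)) (Λ (k+2))
        + δ * ((A *ᵥ θ (k+2) + B *ᵥ ξ (k+2)) ⬝ᵥ (A *ᵥ θ (k+2) + B *ᵥ ξ (k+2))
          + (B *ᵥ ξ (k+2) - B *ᵥ ξ (k+1)) ⬝ᵥ (B *ᵥ ξ (k+2) - B *ᵥ ξ (k+1)))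
      ≤ lyapunov σ μ c A B ξs Λs (θ (k+1)) (ξ (k+1)) (Λ (k+1)) := by
  have hA := congrArg (· ⬝ᵥ (θ (k+2) - θs)) ((h.stationary (k+1)).trans hs.stationary.symm)
  have hB := hs.subgradient.monotone (h.subgradient (k+1))
  have hC := (h.subgradient k).monotone (h.subgradient (k+1))
  simp only [← mulVec_sub, transpose_mulVec_dotProduct] at hA hB hC
  have hθs : A *ᵥ θs = - (B *ᵥ ξs) := eq_neg_of_add_eq_zero_left hs.feasible
  have hr := residual_decrease hσ hμ hcδ (Λ (k+1) - Λs) (B *ᵥ ξ (k+1) - B *ᵥ ξs)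
    (A *ᵥ θ (k+1) + B *ᵥ ξ (k+1)) (B *ᵥ ξ (k+2) - B *ᵥ ξ (k+1))
    (A *ᵥ θ (k+2) + B *ᵥ ξ (k+2)) ?_ ?_ ?_
  · have e1 : Λ (k+2) - Λs = Λ (k+1) - Λs - (μ * σ) • (A *ᵥ θ (k+2) + B *ᵥ ξ (k+2)) := by
      rw [h.dual (k+1)]
      abel
    have e2 : B *ᵥ ξ (k+2) - B *ᵥ ξs
        = B *ᵥ ξ (k+1) - B *ᵥ ξs + (B *ᵥ ξ (k+2) - B *ᵥ ξ (k+1)) := by abel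
    rw [lyapunov, lyapunov, e1, e2]
    exact hr
  · have e1 : Λ (k+1) - Λs - σ • (A *ᵥ θ (k+2) + B *ᵥ ξ (k+2))
        + σ • (B *ᵥ ξ (k+2) - B *ᵥ ξ (k+1))
        = (Λ (k+1) - σ • (A *ᵥ θ (k+2) + B *ᵥ ξ (k+1))) - Λs := by module
    have e2 : A *ᵥ θ (k+2) + B *ᵥ ξ (k+2)
        - (B *ᵥ ξ (k+1) - B *ᵥ ξs + (B *ᵥ ξ (k+2) - B *ᵥ ξ (k+1)))
        = A *ᵥ (θ (k+2) - θs) := by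
      rw [mulVec_sub, hθs]
      abel
    rw [e1, e2, sub_dotProduct, sub_eq_zero]
    exact hA
  · convert hB using 2
    · module
    · rw [mulVec_sub]
      abel
  · rw [h.dual k, mulVec_sub] at hC
    have e : Λ k - (μ * σ) • (A *ᵥ θ (k+1) + B *ᵥ ξ (k+1)) - σ • (A *ᵥ θ (k+2) + B *ᵥ ξ (k+2))
        - (Λ k - σ • (A *ᵥ θ (k+1) + B *ᵥ ξ (k+1)))
        = σ • ((1 - μ) • (A *ᵥ θ (k+1) + B *ᵥ ξ (k+1)) - (A *ᵥ θ (k+2) + B *ᵥ ξ (k+2))) := by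
      module
    refine nonneg_of_mul_nonneg_right ?_ hσ
    rw [← smul_eq_mul, ← smul_dotProduct, ← e]
    exact hC

lemma lyapunov_nonneg (hσ : 0 < σ) (hμ : 0 < μ) (hc : 0 ≤ c) (t : Fin m → ℝ) (s : Fin q → ℝ)
    (l : Fin n → ℝ) : 0 ≤ lyapunov σ μ c A B ξs Λs t s l := by
  have := dotProduct_self_nonneg_real (l - Λs)
  have := dotProduct_self_nonneg_real (B *ᵥ s - B *ᵥ ξs)
  have := dotProduct_self_nonneg_real (A *ᵥ t + B *ᵥ s)
  unfold lyapunov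
  positivity

lemma dual_le_lyapunov (hσ : 0 < σ) (hμ : 0 < μ) (hc : 0 ≤ c) (t : Fin m → ℝ) (s : Fin q → ℝ)
    (l : Fin n → ℝ) :
    (l - Λs) ⬝ᵥ (l - Λs) ≤ μ * σ ^ 2 * lyapunov σ μ c A B ξs Λs t s l := by
  have h1 := dotProduct_self_nonneg_real (B *ᵥ s - B *ᵥ ξs)
  have h2 := mul_nonneg hc (dotProduct_self_nonneg_real (A *ᵥ t + B *ᵥ s))
  rw [← div_le_iff₀' (by positivity)]
  unfold lyapunov
  linarith

lemma primal_le_lyapunov (hσ : 0 < σ) (hμ : 0 < μ) (hc : 0 ≤ c) (t : Fin m → ℝ) (s : Fin q → ℝ)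
    (l : Fin n → ℝ) :
    (B *ᵥ s - B *ᵥ ξs) ⬝ᵥ (B *ᵥ s - B *ᵥ ξs) ≤ lyapunov σ μ c A B ξs Λs t s l := by
  have h1 : 0 ≤ (l - Λs) ⬝ᵥ (l - Λs) / (μ * σ ^ 2) :=
    div_nonneg (dotProduct_self_nonneg_real _) (by positivity)
  have h2 := mul_nonneg hc (dotProduct_self_nonneg_real (A *ᵥ t + B *ᵥ s))
  unfold lyapunov
  linarith

lemma IsADMM.antitone_lyapunov (h : IsADMM σ μ A B y g θ ξ Λ) (hs : IsKKT A B y g θs ξs Λs)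
    (hσ : 0 < σ) (hμ : 0 < μ) (hδ : 0 < δ)
    (hcδ : ∀ X D R S : ℝ, 0 ≤ X → 0 ≤ D → 0 ≤ R →
      (∀ t : ℝ, 0 ≤ t ^ 2 * D + 2 * t * S + R) →
      (c + δ) * X + δ * D - c * R ≤ (2 - μ) * X + D - 2 * (1 - μ) * S) :
    Antitone fun k => lyapunov σ μ c A B ξs Λs (θ (k+1)) (ξ (k+1)) (Λ (k+1)) := by
  refine antitone_nat_of_succ_le fun k => le_trans ?_ (h.lyapunov_decrease hs hσ hμ hcδ k)
  exact le_add_of_nonneg_right (mul_nonneg hδ.le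
    (add_nonneg (dotProduct_self_nonneg_real _) (dotProduct_self_nonneg_real _)))

lemma IsADMM.tendsto_residuals (h : IsADMM σ μ A B y g θ ξ Λ) (hs : IsKKT A B y g θs ξs Λs)
    (hσ : 0 < σ) (hμ : 0 < μ) (hc : 0 ≤ c) (hδ : 0 < δ)
    (hcδ : ∀ X D R S : ℝ, 0 ≤ X → 0 ≤ D → 0 ≤ R →
      (∀ t : ℝ, 0 ≤ t ^ 2 * D + 2 * t * S + R) →
      (c + δ) * X + δ * D - c * R ≤ (2 - μ) * X + D - 2 * (1 - μ) * S) :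
    Tendsto (fun k => A *ᵥ θ k + B *ᵥ ξ k) atTop (nhds 0) ∧
      Tendsto (fun k => B *ᵥ ξ (k+1) - B *ᵥ ξ k) atTop (nhds 0) := by
  set W := fun k => lyapunov σ μ c A B ξs Λs (θ (k+1)) (ξ (k+1)) (Λ (k+1)) with hW
  have hlim := tendsto_atTop_ciInf (h.antitone_lyapunov hs hσ hμ hδ hcδ)
    ⟨0, Set.forall_mem_range.2 fun k => lyapunov_nonneg hσ hμ hc _ _ _⟩
  have hdiff : Tendsto (fun k => (W k - W (k+1)) / δ) atTop (nhds 0) := by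
    simpa using (hlim.sub (hlim.comp (tendsto_add_atTop_nat 1))).div_const δ
  have hle : ∀ k, (A *ᵥ θ (k+2) + B *ᵥ ξ (k+2)) ⬝ᵥ (A *ᵥ θ (k+2) + B *ᵥ ξ (k+2))
      + (B *ᵥ ξ (k+2) - B *ᵥ ξ (k+1)) ⬝ᵥ (B *ᵥ ξ (k+2) - B *ᵥ ξ (k+1))
      ≤ (W k - W (k+1)) / δ := fun k => by
    rw [le_div_iff₀' hδ]
    have := h.lyapunov_decrease hs hσ hμ hcδ k
    simp only [hW]
    linarith
  constructor
  · rw [← tendsto_add_atTop_iff_nat 2]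
    refine tendsto_zero_of_dotProduct_self (squeeze_zero
      (fun k => dotProduct_self_nonneg_real _) (fun k => ?_) hdiff)
    exact (le_add_of_nonneg_right (dotProduct_self_nonneg_real _)).trans (hle k)
  · rw [← tendsto_add_atTop_iff_nat 1]
    refine tendsto_zero_of_dotProduct_self (squeeze_zero
      (fun k => dotProduct_self_nonneg_real _) (fun k => ?_) hdiff)
    exact (le_add_of_nonneg_left (dotProduct_self_nonneg_real _)).trans (hle k)

/-- If the residuals vanish, every accumulation point of ADMM is a KKT point. -/
lemma IsADMM.isKKT_of_tendsto (h : IsADMM σ μ A B y g θ ξ Λ) (hg : LowerSemicontinuous g)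
    (hr : Tendsto (fun k => A *ᵥ θ k + B *ᵥ ξ k) atTop (nhds 0))
    (hd : Tendsto (fun k => B *ᵥ ξ (k+1) - B *ᵥ ξ k) atTop (nhds 0))
    {φ : ℕ → ℕ} (hφ : StrictMono φ) {θi : Fin m → ℝ} {ξi : Fin q → ℝ} {Λi : Fin n → ℝ}
    (hθ : Tendsto (fun k => θ (φ k)) atTop (nhds θi))
    (hξ : Tendsto (fun k => ξ (φ k)) atTop (nhds ξi))
    (hΛ : Tendsto (fun k => Λ (φ k)) atTop (nhds Λi)) : IsKKT A B y g θi ξi Λi := by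
  refine ⟨?_, ?_, ?_⟩
  · have h1 : Tendsto (fun k => A *ᵥ θ (k+1) + B *ᵥ ξ k) atTop (nhds 0) := by
      have := ((tendsto_add_atTop_iff_nat 1).2 hr).sub hd
      rw [sub_zero] at this
      exact this.congr fun k => by abel
    have h2 : Tendsto (fun k => Λ (φ k) - σ • (A *ᵥ θ (φ k + 1) + B *ᵥ ξ (φ k))) atTop
        (nhds Λi) := by
      simpa using hΛ.sub ((h1.comp hφ.tendsto_atTop).const_smul σ)
    have h3 := tendsto_mulVec Aᵀ h2
    simp only [h.stationary] at h3
    exact tendsto_nhds_unique h3 tendsto_const_nhds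
  · have h2 : Tendsto (fun k => Λ (φ k) + ((μ - 1) * σ) • (A *ᵥ θ (φ k) + B *ᵥ ξ (φ k))) atTop
        (nhds Λi) := by
      simpa using hΛ.add ((hr.comp hφ.tendsto_atTop).const_smul ((μ - 1) * σ))
    refine IsSubgradient.of_tendsto hg hξ (tendsto_mulVec Bᵀ h2) ?_
    filter_upwards [hφ.tendsto_atTop.eventually_ge_atTop 1] with k hk
    obtain ⟨j, hj⟩ := Nat.exists_eq_add_of_le' hk
    rw [hj]
    convert h.subgradient j using 2
    rw [h.dual j]
    module
  · exact tendsto_nhds_unique ((tendsto_mulVec A hθ).add (tendsto_mulVec B hξ))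
      (hr.comp hφ.tendsto_atTop)

lemma IsADMM.exists_subseq_tendsto (h : IsADMM σ μ A B y g θ ξ Λ)
    (hs : IsKKT A B y g θs ξs Λs) (hσ : 0 < σ) (hμ : 0 < μ) (hc : 0 ≤ c) (hδ : 0 < δ)
    (hcδ : ∀ X D R S : ℝ, 0 ≤ X → 0 ≤ D → 0 ≤ R →
      (∀ t : ℝ, 0 ≤ t ^ 2 * D + 2 * t * S + R) →
      (c + δ) * X + δ * D - c * R ≤ (2 - μ) * X + D - 2 * (1 - μ) * S)
    (hA : (Aᵀ * A).PosDef) (hB : (Bᵀ * B).PosDef) :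
    ∃ φ : ℕ → ℕ, StrictMono φ ∧ ∃ θi ξi Λi, Tendsto (fun k => θ (φ k)) atTop (nhds θi) ∧
      Tendsto (fun k => ξ (φ k)) atTop (nhds ξi) ∧
      Tendsto (fun k => Λ (φ k)) atTop (nhds Λi) := by
  have hanti := h.antitone_lyapunov hs hσ hμ hδ hcδ
  have hr := (h.tendsto_residuals hs hσ hμ hc hδ hcδ).1
  set M := lyapunov σ μ c A B ξs Λs (θ 1) (ξ 1) (Λ 1)
  have hM : ∀ k, lyapunov σ μ c A B ξs Λs (θ (k+1)) (ξ (k+1)) (Λ (k+1)) ≤ M :=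
    fun k => hanti (Nat.zero_le k)
  obtain ⟨⟨u, p⟩, -, ψ, hψ, hup⟩ := tendsto_subseq_of_bounded
    (x := fun k => (Λ (k+1) - Λs, B *ᵥ ξ (k+1) - B *ᵥ ξs))
    (Metric.isBounded_closedBall (x := 0) (r := max √(μ * σ ^ 2 * M) √M)) fun k => by
      rw [mem_closedBall_zero_iff, Prod.norm_def]
      refine max_le_max (norm_le_of_dotProduct_self_le ?_) (norm_le_of_dotProduct_self_le ?_)
      · exact (dual_le_lyapunov hσ hμ hc _ _ _).trans
          (mul_le_mul_of_nonneg_left (hM k) (by positivity))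
      · exact (primal_le_lyapunov hσ hμ hc _ _ _).trans (hM k)
  have hφ : StrictMono fun k => ψ k + 1 := fun a b hab => Nat.succ_lt_succ (hψ hab)
  have hu := (hup.fst_nhds).add_const Λs
  have hp := (hup.snd_nhds).add_const (B *ᵥ ξs)
  simp only [Function.comp_def, sub_add_cancel] at hu hp
  have ha := (hr.comp hφ.tendsto_atTop).sub hp
  simp only [Function.comp_def, add_sub_cancel_right] at ha
  obtain ⟨ξi, hξi⟩ := tendsto_of_tendsto_mulVec hB hp
  obtain ⟨θi, hθi⟩ := tendsto_of_tendsto_mulVec hA ha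
  exact ⟨_, hφ, θi, ξi, _, hθi, hξi, hu⟩

/-- An accumulation point that is a KKT point is the limit of the whole sequence. -/
lemma IsADMM.tendsto_of_subseq (h : IsADMM σ μ A B y g θ ξ Λ)
    (hs : IsKKT A B y g θs ξs Λs) (hσ : 0 < σ) (hμ : 0 < μ) (hc : 0 ≤ c) (hδ : 0 < δ)
    (hcδ : ∀ X D R S : ℝ, 0 ≤ X → 0 ≤ D → 0 ≤ R →
      (∀ t : ℝ, 0 ≤ t ^ 2 * D + 2 * t * S + R) →
      (c + δ) * X + δ * D - c * R ≤ (2 - μ) * X + D - 2 * (1 - μ) * S)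
    (hA : (Aᵀ * A).PosDef) (hB : (Bᵀ * B).PosDef)
    {φ : ℕ → ℕ} (hφ : StrictMono φ)
    (hξ : Tendsto (fun k => ξ (φ k)) atTop (nhds ξs))
    (hΛ : Tendsto (fun k => Λ (φ k)) atTop (nhds Λs)) :
    Tendsto θ atTop (nhds θs) ∧ Tendsto ξ atTop (nhds ξs) ∧ Tendsto Λ atTop (nhds Λs) := by
  have hr := (h.tendsto_residuals hs hσ hμ hc hδ hcδ).1
  set W := fun k => lyapunov σ μ c A B ξs Λs (θ k) (ξ k) (Λ k) with hW
  have hWφ : Tendsto (fun k => W (φ k)) atTop (nhds 0) := by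
    have h1 := hΛ.sub_const Λs
    have h2 := (tendsto_mulVec B hξ).sub_const (B *ᵥ ξs)
    have h3 := hr.comp hφ.tendsto_atTop
    simpa [hW, lyapunov] using (((tendsto_dotProduct h1 h1).div_const (μ * σ ^ 2)).add
      (tendsto_dotProduct h2 h2)).add ((tendsto_dotProduct h3 h3).const_mul c)
  have hlim := tendsto_atTop_ciInf (h.antitone_lyapunov hs hσ hμ hδ hcδ)
    ⟨0, Set.forall_mem_range.2 fun k => lyapunov_nonneg hσ hμ hc _ _ _⟩
  have hlim' := (tendsto_add_atTop_iff_nat (f := W) 1).1 hlim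
  have hW0 : Tendsto W atTop (nhds 0) := by
    rwa [tendsto_nhds_unique (hlim'.comp hφ.tendsto_atTop) hWφ] at hlim'
  have hΛ' : Tendsto Λ atTop (nhds Λs) := by
    rw [← tendsto_sub_nhds_zero_iff]
    refine tendsto_zero_of_dotProduct_self (squeeze_zero
      (g := fun k => μ * σ ^ 2 * W k) (fun k => dotProduct_self_nonneg_real _)
      (fun k => dual_le_lyapunov hσ hμ hc _ _ _) ?_)
    simpa using hW0.const_mul (μ * σ ^ 2)
  have hp : Tendsto (fun k => B *ᵥ ξ k) atTop (nhds (B *ᵥ ξs)) := by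
    rw [← tendsto_sub_nhds_zero_iff]
    exact tendsto_zero_of_dotProduct_self (squeeze_zero (fun k => dotProduct_self_nonneg_real _)
      (fun k => primal_le_lyapunov hσ hμ hc _ _ _) hW0)
  have ha : Tendsto (fun k => A *ᵥ θ k) atTop (nhds (A *ᵥ θs)) := by
    have := hr.sub hp
    rw [zero_sub, ← eq_neg_of_add_eq_zero_left hs.feasible] at this
    exact this.congr fun k => by abel
  obtain ⟨LA, hLA⟩ := exists_leftInverse_of_posDef hA
  obtain ⟨LB, hLB⟩ := exists_leftInverse_of_posDef hB
  exact ⟨by simpa only [hLA] using tendsto_mulVec LA ha,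
    by simpa only [hLB] using tendsto_mulVec LB hp, hΛ'⟩

end Convergence

lemma IsKKT.isOptimal {n m q : ℕ} {A : Matrix (Fin n) (Fin m) ℝ} {B : Matrix (Fin n) (Fin q) ℝ}
    {y : Fin m → ℝ} {g : (Fin q → ℝ) → ℝ} {θs : Fin m → ℝ} {ξs : Fin q → ℝ} {Λs : Fin n → ℝ}
    (hs : IsKKT A B y g θs ξs Λs) {t : Fin m → ℝ} {s : Fin q → ℝ}
    (hts : A *ᵥ t + B *ᵥ s = 0) : y ⬝ᵥ θs + g ξs ≤ y ⬝ᵥ t + g s := by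
  have h1 := hs.subgradient s
  have h2 := congrArg (Λs ⬝ᵥ ·) (hts.trans hs.feasible.symm)
  simp only [dotProduct_add] at h2
  rw [transpose_mulVec_dotProduct, mulVec_sub, dotProduct_sub] at h1
  rw [← hs.stationary, transpose_mulVec_dotProduct, transpose_mulVec_dotProduct]
  linarith

lemma exists_sqrt_dotProduct_self_le {n : ℕ} {v : ℕ → Fin n → ℝ} {x : Fin n → ℝ}
    (h : Tendsto v atTop (nhds x)) : ∃ M, ∀ k, √(v k ⬝ᵥ v k) ≤ M := by
  obtain ⟨M, hM⟩ := (tendsto_dotProduct h h).sqrt.bddAbove_range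
  exact ⟨M, fun k => hM ⟨k, rfl⟩⟩

/-- Global convergence of ADMM for `min ⟨y,θ⟩ + g(ξ)` s.t. `Aθ + Bξ = 0` with
`μ ∈ (0,(1+√5)/2)` and `AᵀA`, `BᵀB` positive definite: the sequence
`(θ^k, ξ^k, Λ^k)` is bounded, every accumulation point satisfies the KKT
conditions, and the whole sequence converges, `(θ^k, ξ^k)` to an optimal
solution and `Λ^k` to an associated Lagrange multiplier. -/
theorem stmt_13 (n m q : ℕ) (σ μ : ℝ) (hσ : 0 < σ)
    (hμ : μ ∈ Set.Ioo (0:ℝ) ((1 + Real.sqrt 5) / 2))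
    (A : Matrix (Fin n) (Fin m) ℝ) (B : Matrix (Fin n) (Fin q) ℝ)
    (hAtA : (A.transpose * A).PosDef) (hBtB : (B.transpose * B).PosDef)
    (y : Fin m → ℝ)
    (g : (Fin q → ℝ) → ℝ)
    (hconv : ConvexOn ℝ Set.univ g) (hlsc : LowerSemicontinuous g)
    (θ : ℕ → Fin m → ℝ) (ξ : ℕ → Fin q → ℝ) (Λ : ℕ → Fin n → ℝ)
    (hθ : ∀ k, ∀ t : Fin m → ℝ,
      (∑ i, y i * θ (k+1) i) - (Λ k) ⬝ᵥ (A *ᵥ θ (k+1))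
          + (σ/2) * ((A *ᵥ θ (k+1) + B *ᵥ ξ k) ⬝ᵥ (A *ᵥ θ (k+1) + B *ᵥ ξ k))
        ≤ (∑ i, y i * t i) - (Λ k) ⬝ᵥ (A *ᵥ t)
          + (σ/2) * ((A *ᵥ t + B *ᵥ ξ k) ⬝ᵥ (A *ᵥ t + B *ᵥ ξ k)))
    (hξ : ∀ k, ∀ s : Fin q → ℝ,
      g (ξ (k+1)) - (Λ k) ⬝ᵥ (B *ᵥ ξ (k+1))
          + (σ/2) * ((A *ᵥ θ (k+1) + B *ᵥ ξ (k+1)) ⬝ᵥ (A *ᵥ θ (k+1) + B *ᵥ ξ (k+1)))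
        ≤ g s - (Λ k) ⬝ᵥ (B *ᵥ s)
          + (σ/2) * ((A *ᵥ θ (k+1) + B *ᵥ s) ⬝ᵥ (A *ᵥ θ (k+1) + B *ᵥ s)))
    (hΛ : ∀ k, Λ (k+1) = Λ k - (μ * σ) • (A *ᵥ θ (k+1) + B *ᵥ ξ (k+1)))
    -- a KKT point exists
    (θs : Fin m → ℝ) (ξs : Fin q → ℝ) (Λs : Fin n → ℝ)
    (hk1 : A.transpose *ᵥ Λs = y)
    (hk2 : ∀ z : Fin q → ℝ,
      g ξs + ∑ j, (B.transpose *ᵥ Λs) j * (z j - ξs j) ≤ g z)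
    (hk3 : A *ᵥ θs + B *ᵥ ξs = 0) :
    -- boundedness of the full sequence
    (∃ M : ℝ, ∀ k,
      Real.sqrt (θ k ⬝ᵥ θ k) ≤ M ∧ Real.sqrt (ξ k ⬝ᵥ ξ k) ≤ M ∧
      Real.sqrt (Λ k ⬝ᵥ Λ k) ≤ M) ∧
    -- every accumulation point is a KKT point
    (∀ (φ : ℕ → ℕ), StrictMono φ →
      ∀ (θi : Fin m → ℝ) (ξi : Fin q → ℝ) (Λi : Fin n → ℝ),
        Tendsto (fun k => θ (φ k)) atTop (nhds θi) →
        Tendsto (fun k => ξ (φ k)) atTop (nhds ξi) →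
        Tendsto (fun k => Λ (φ k)) atTop (nhds Λi) →
        A.transpose *ᵥ Λi = y ∧
        (∀ z : Fin q → ℝ,
          g ξi + ∑ j, (B.transpose *ᵥ Λi) j * (z j - ξi j) ≤ g z) ∧
        A *ᵥ θi + B *ᵥ ξi = 0) ∧
    -- the whole sequence converges to an optimal solution / multiplier
    (∃ (θi : Fin m → ℝ) (ξi : Fin q → ℝ) (Λi : Fin n → ℝ),
      Tendsto θ atTop (nhds θi) ∧ Tendsto ξ atTop (nhds ξi) ∧
      Tendsto Λ atTop (nhds Λi) ∧
      A *ᵥ θi + B *ᵥ ξi = 0 ∧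
      (∀ (t : Fin m → ℝ) (s : Fin q → ℝ), A *ᵥ t + B *ᵥ s = 0 →
        (∑ i, y i * θi i) + g ξi ≤ (∑ i, y i * t i) + g s) ∧
      A.transpose *ᵥ Λi = y ∧
      (∀ z : Fin q → ℝ,
        g ξi + ∑ j, (B.transpose *ᵥ Λi) j * (z j - ξi j) ≤ g z)) := by
  have hy : ConvexOn ℝ Set.univ fun t : Fin m → ℝ => y ⬝ᵥ t :=
    ⟨convex_univ, fun a _ b _ s t _ _ _ => by
      simp only [dotProduct_add, dotProduct_smul, le_refl]⟩
  have hadmm : IsADMM σ μ A B y g θ ξ Λ :=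
    { stationary := fun k => by
        rw [add_comm (A *ᵥ _)]
        refine eq_of_isSubgradient_linear (x := θ (k+1))
          (isSubgradient_of_isMin hσ A hy (Λ k) (B *ᵥ ξ k) (θ (k+1)) fun t => ?_)
        rw [add_comm (B *ᵥ _), add_comm (B *ᵥ _)]
        exact hθ k t
      subgradient := fun k => isSubgradient_of_isMin hσ B hconv _ _ _ (hξ k)
      dual := hΛ }
  have hs : IsKKT A B y g θs ξs Λs := ⟨hk1, hk2, hk3⟩
  obtain ⟨c, δ, hc, hδ, hcδ⟩ := exists_decrease_constants hμ
  obtain ⟨hr, hd⟩ := hadmm.tendsto_residuals hs hσ hμ.1 hc hδ hcδ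
  obtain ⟨φ, hφ, θi, ξi, Λi, hθi, hξi, hΛi⟩ :=
    hadmm.exists_subseq_tendsto hs hσ hμ.1 hc hδ hcδ hAtA hBtB
  have hi := hadmm.isKKT_of_tendsto hlsc hr hd hφ hθi hξi hΛi
  obtain ⟨hθl, hξl, hΛl⟩ :=
    hadmm.tendsto_of_subseq hi hσ hμ.1 hc hδ hcδ hAtA hBtB hφ hξi hΛi
  refine ⟨?_, ?_, θi, ξi, Λi, hθl, hξl, hΛl, hi.feasible, fun t s hts => hi.isOptimal hts,
    hi.stationary, hi.subgradient⟩
  · obtain ⟨M₁, h₁⟩ := exists_sqrt_dotProduct_self_le hθl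
    obtain ⟨M₂, h₂⟩ := exists_sqrt_dotProduct_self_le hξl
    obtain ⟨M₃, h₃⟩ := exists_sqrt_dotProduct_self_le hΛl
    exact ⟨max M₁ (max M₂ M₃), fun k => ⟨(h₁ k).trans (le_max_left _ _),
      (h₂ k).trans ((le_max_left _ _).trans (le_max_right _ _)),
      (h₃ k).trans ((le_max_right _ _).trans (le_max_right _ _))⟩⟩
  · intro ψ hψ θj ξj Λj hθj hξj hΛj
    have hj := hadmm.isKKT_of_tendsto hlsc hr hd hψ hθj hξj hΛj
    exact ⟨hj.stationary, hj.subgradient, hj.feasible⟩
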